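/- On ℝ³ with the Jacobi structure Λ^{12} = 0, Λ^{13} = −x·e^{x}, Λ^{23} = e^{x}(z − y − 1 + e^{x}), E = (0, e^{x}, e^{x}(1 − x)): the functions f₁ = e^{−e^{−x}y} and f₂ = 1 satisfy {f₁, f₂} = f₁; the function h = e^{x} + (x − 1)y + z − 1 satisfies {h, f₁} = 0 and {h, f₂} = 0; the Hamiltonian vector field of h equals X_h = (x·e^{x}, x·y·e^{x}, −x(x·y·e^{x} + e^{2x})); and X_h commutes with the Hamiltonian vector fields X₁ = (0, e^{x−e^{−x}y}, −e^{−e^{−x}y}(x·e^{x} + x·y − y + z − 1)) and X₂ = (0, e^{x}, e^{x}(1 − x)) of f₁ and f₂, i.e., [X_h, X₁] = 0 and [X_h, X₂] = 0; moreover [X₁, X₂] = X₁. -/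

import Mathlib

open Real

/-- Partial derivative `∂_μ f` on `ℝ³`. -/
noncomputable def pd (μ : Fin 3) (f : (Fin 3 → ℝ) → ℝ) (p : Fin 3 → ℝ) : ℝ :=
  fderiv ℝ f p (Pi.single μ 1)

/-- The Hamiltonian vector field of `f` with respect to a bivector `Λ` and a
vector field `E` on `ℝ³`: `X_f^ν = Σ_μ (∂_μ f)·Λ^{μν} + f·E^ν`. -/
noncomputable def hamVF (Λ : (Fin 3 → ℝ) → Fin 3 → Fin 3 → ℝ)
    (E : (Fin 3 → ℝ) → Fin 3 → ℝ) (f : (Fin 3 → ℝ) → ℝ) (p : Fin 3 → ℝ) : Fin 3 → ℝ :=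
  fun ν => (∑ μ : Fin 3, pd μ f p * Λ p μ ν) + f p * E p ν

/-- The Jacobi bracket of `f, g`:
`{f,g} = Σ_{μ,ν} Λ^{μν}·(∂_μ f)·(∂_ν g) + f·(Eg) − g·(Ef)`. -/
noncomputable def jb (Λ : (Fin 3 → ℝ) → Fin 3 → Fin 3 → ℝ)
    (E : (Fin 3 → ℝ) → Fin 3 → ℝ) (f g : (Fin 3 → ℝ) → ℝ) (p : Fin 3 → ℝ) : ℝ :=
  (∑ μ : Fin 3, ∑ ν : Fin 3, Λ p μ ν * pd μ f p * pd ν g p)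
    + f p * (∑ μ : Fin 3, E p μ * pd μ g p)
    - g p * (∑ μ : Fin 3, E p μ * pd μ f p)

/-- The Lie bracket of vector fields on `ℝ³`:
`[X,Y](p) = DY(p)(X(p)) − DX(p)(Y(p))`. -/
noncomputable def lieBr (X Y : (Fin 3 → ℝ) → (Fin 3 → ℝ)) (p : Fin 3 → ℝ) : Fin 3 → ℝ :=
  fderiv ℝ Y p (X p) - fderiv ℝ X p (Y p)

/-- The bivector with `Λ^{12} = 0`, `Λ^{13} = −x·e^{x}`,
`Λ^{23} = e^{x}(z − y − 1 + e^{x})`. -/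
noncomputable def Lam : (Fin 3 → ℝ) → Fin 3 → Fin 3 → ℝ := fun p =>
  ![![0, 0, -(p 0 * exp (p 0))],
    ![0, 0, exp (p 0) * (p 2 - p 1 - 1 + exp (p 0))],
    ![p 0 * exp (p 0), -(exp (p 0) * (p 2 - p 1 - 1 + exp (p 0))), 0]]

/-- The Reeb vector field `E = (0, e^{x}, e^{x}(1 − x))`. -/
noncomputable def Evec : (Fin 3 → ℝ) → Fin 3 → ℝ := fun p =>
  ![0, exp (p 0), exp (p 0) * (1 - p 0)]

/-- f₁ = e^{−e^{−x}y}. -/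
noncomputable def f₁ : (Fin 3 → ℝ) → ℝ := fun q => exp (-(exp (-q 0) * q 1))

/-- f₂ = 1. -/
noncomputable def f₂ : (Fin 3 → ℝ) → ℝ := fun _ => 1

/-- h = e^{x} + (x − 1)y + z − 1. -/
noncomputable def h : (Fin 3 → ℝ) → ℝ := fun q =>
  exp (q 0) + (q 0 - 1) * q 1 + q 2 - 1

/-- X_h = (x·e^{x}, x·y·e^{x}, −x(x·y·e^{x} + e^{2x})). -/
noncomputable def Xh : (Fin 3 → ℝ) → (Fin 3 → ℝ) := fun p =>
  ![p 0 * exp (p 0), p 0 * p 1 * exp (p 0),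
    -(p 0 * (p 0 * p 1 * exp (p 0) + exp (2 * p 0)))]

/-- X₁ = (0, e^{x−e^{−x}y}, −e^{−e^{−x}y}(x·e^{x} + x·y − y + z − 1)). -/
noncomputable def X₁ : (Fin 3 → ℝ) → (Fin 3 → ℝ) := fun p =>
  ![0, exp (p 0 - exp (-p 0) * p 1),
    -(exp (-(exp (-p 0) * p 1)) * (p 0 * exp (p 0) + p 0 * p 1 - p 1 + p 2 - 1))]

/-- X₂ = (0, e^{x}, e^{x}(1 − x)). -/
noncomputable def X₂ : (Fin 3 → ℝ) → (Fin 3 → ℝ) := fun p =>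
  ![0, exp (p 0), exp (p 0) * (1 - p 0)]

theorem fderiv_vec3 {a b c : (Fin 3 → ℝ) → ℝ} {p : Fin 3 → ℝ} (ha : DifferentiableAt ℝ a p)
    (hb : DifferentiableAt ℝ b p) (hc : DifferentiableAt ℝ c p) (v : Fin 3 → ℝ) :
    fderiv ℝ (fun q => ![a q, b q, c q]) p v =
      ![fderiv ℝ a p v, fderiv ℝ b p v, fderiv ℝ c p v] := by
  have hd : ∀ i, DifferentiableAt ℝ (fun q => ![a q, b q, c q] i) p := by
    intro i
    fin_cases i <;> assumption
  rw [fderiv_pi hd]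
  ext i
  fin_cases i <;> rfl

theorem fderiv_coord (i : Fin 3) (p v : Fin 3 → ℝ) :
    fderiv ℝ (fun q : Fin 3 → ℝ => q i) p v = v i := by
  rw [(hasFDerivAt_apply i p).fderiv]
  rfl

theorem fderiv_f₁ (p v : Fin 3 → ℝ) :
    fderiv ℝ f₁ p v = f₁ p * (exp (-p 0) * (p 1 * v 0 - v 1)) := by
  unfold f₁
  simp (disch := fun_prop) [fderiv_exp, fderiv_fun_neg, fderiv_fun_mul, fderiv_coord]
  ring

theorem fderiv_f₂ (p v : Fin 3 → ℝ) : fderiv ℝ f₂ p v = 0 := by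
  unfold f₂
  simp

theorem fderiv_h (p v : Fin 3 → ℝ) :
    fderiv ℝ h p v = (exp (p 0) + p 1) * v 0 + (p 0 - 1) * v 1 + v 2 := by
  unfold h
  simp (disch := fun_prop) [fderiv_exp, fderiv_fun_add, fderiv_fun_sub, fderiv_fun_mul,
    fderiv_coord]
  ring

theorem fderiv_Xh (p v : Fin 3 → ℝ) :
    fderiv ℝ Xh p v =
      ![(1 + p 0) * exp (p 0) * v 0,
        exp (p 0) * ((1 + p 0) * p 1 * v 0 + p 0 * v 1),
        -((p 0 * (2 + p 0) * p 1 * exp (p 0) + (1 + 2 * p 0) * exp (p 0) ^ 2) * v 0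
          + p 0 ^ 2 * exp (p 0) * v 1)] := by
  have he : exp (2 * p 0) = exp (p 0) ^ 2 := by rw [← exp_nat_mul]; norm_num
  unfold Xh
  rw [fderiv_vec3 (by fun_prop) (by fun_prop) (by fun_prop)]
  ext i
  fin_cases i <;>
  · simp (disch := fun_prop) [fderiv_exp, fderiv_fun_neg, fderiv_fun_add, fderiv_fun_mul,
      fderiv_coord, he]
    ring

theorem fderiv_X₂ (p v : Fin 3 → ℝ) :
    fderiv ℝ X₂ p v = ![0, exp (p 0) * v 0, -(p 0 * exp (p 0) * v 0)] := by
  unfold X₂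
  rw [fderiv_vec3 (by fun_prop) (by fun_prop) (by fun_prop)]
  ext i
  fin_cases i
  · simp
  · simp (disch := fun_prop) [fderiv_exp, fderiv_coord]
  · simp (disch := fun_prop) [fderiv_exp, fderiv_fun_sub, fderiv_fun_mul, fderiv_coord]
    ring

theorem X₁_eq : X₁ = fun p => ![0, exp (p 0) * f₁ p,
    -(f₁ p * (p 0 * exp (p 0) + p 0 * p 1 - p 1 + p 2 - 1))] := by
  funext p
  simp only [X₁, f₁, sub_eq_add_neg, exp_add]

theorem differentiable_f₁ : Differentiable ℝ f₁ := by
  unfold f₁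
  fun_prop

theorem fderiv_X₁ (p v : Fin 3 → ℝ) :
    fderiv ℝ X₁ p v =
      ![0,
        f₁ p * (exp (p 0) * v 0 + exp (p 0) * exp (-p 0) * (p 1 * v 0 - v 1)),
        -(f₁ p * (exp (-p 0) * (p 1 * v 0 - v 1) *
            (p 0 * exp (p 0) + p 0 * p 1 - p 1 + p 2 - 1) +
          ((1 + p 0) * exp (p 0) + p 1) * v 0 + (p 0 - 1) * v 1 + v 2))] := by
  have hf := differentiable_f₁
  rw [X₁_eq, fderiv_vec3 (by fun_prop) (by fun_prop) (by fun_prop)]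
  ext i
  fin_cases i
  · simp
  · simp (disch := fun_prop) [fderiv_exp, fderiv_fun_mul, fderiv_coord, fderiv_f₁]
    ring
  · simp (disch := fun_prop) [fderiv_exp, fderiv_fun_neg, fderiv_fun_add, fderiv_fun_sub,
      fderiv_fun_mul, fderiv_coord, fderiv_f₁]
    ring

/-- On `ℝ³` with the Jacobi structure `(Λ, E)` above: `{f₁, f₂} = f₁`;
`{h, f₁} = 0` and `{h, f₂} = 0`; the Hamiltonian vector field of `h` equals
`X_h`; `X_h` commutes with the Hamiltonian vector fields `X₁`, `X₂` of `f₁`,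
`f₂`; and `[X₁, X₂] = X₁`. -/
theorem stmt_19 (p : Fin 3 → ℝ) :
    jb Lam Evec f₁ f₂ p = f₁ p ∧
    jb Lam Evec h f₁ p = 0 ∧
    jb Lam Evec h f₂ p = 0 ∧
    hamVF Lam Evec h p = Xh p ∧
    hamVF Lam Evec f₁ p = X₁ p ∧
    hamVF Lam Evec f₂ p = X₂ p ∧
    lieBr Xh X₁ p = 0 ∧
    lieBr Xh X₂ p = 0 ∧
    lieBr X₁ X₂ p = X₁ p := by
  have he : exp (-p 0) * exp (p 0) = 1 := by rw [← exp_add]; simp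
  have he2 : exp (2 * p 0) = exp (p 0) ^ 2 := by rw [← exp_nat_mul]; norm_num
  refine ⟨?_, ?_, ?_, ?_, ?_, ?_, ?_, ?_, ?_⟩
  · simp [jb, pd, fderiv_f₁, fderiv_f₂, Fin.sum_univ_three, Lam, Evec]
    simp [f₂]
    linear_combination f₁ p * he
  · simp [jb, pd, fderiv_f₁, fderiv_h, Fin.sum_univ_three, Lam, Evec]
    simp [h]
    grind
  · simp [jb, pd, fderiv_h, fderiv_f₂, Fin.sum_univ_three, Lam, Evec]
    simp [f₂]
    ring
  · ext i
    fin_cases i <;> simp [hamVF, pd, fderiv_h, Fin.sum_univ_three, Lam, Evec, Xh, he2]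
    all_goals
      simp [h]
      ring
  · ext i
    rw [X₁_eq]
    fin_cases i <;> simp [hamVF, pd, fderiv_f₁, Fin.sum_univ_three, Lam, Evec] <;> grind
  · ext i
    fin_cases i <;> simp [hamVF, pd, fderiv_f₂, Lam, Evec, X₂, f₂]
  · ext i
    simp only [lieBr, fderiv_Xh, fderiv_X₁]
    fin_cases i <;> simp [Xh, X₁_eq, he2] <;> grind
  · ext i
    simp only [lieBr, fderiv_Xh, fderiv_X₂]
    fin_cases i <;> simp [Xh, X₂, he2] <;> ring
  · ext i
    simp only [lieBr, fderiv_X₁, fderiv_X₂]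
    fin_cases i <;> simp [X₁_eq, X₂]
    all_goals grind
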